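/- arXiv:1804.09628 — 4 statements merged into one kernel-verified Lean document; each statement's English description precedes it below -/
import Mathlib

section
/- Let q be a prime power, K a finite field with q elements, K̄ an algebraic closure of K, and φ the Frobenius map on P¹(K̄) given by [a : b] ↦ [a^q : b^q]. The number of orbits of the componentwise action of PGL₂(K) on the set of ordered 4-tuples (x₁, x₂, x₃, x₄) of pairwise distinct points of P¹(K̄) satisfying φ(x₁) = x₂, φ(x₂) = x₁, φ(x₃) = x₃ and φ(x₄) = x₄ equals q. -/
open Projectivization

/-! ## The projective line and the actions of `GL₂` and `PGL₂` -/

/-- `GL₂(L)` as a group of linear automorphisms of `L²`. -/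
noncomputable def glMulEquiv (L : Type*) [Field L] :
    GL (Fin 2) L ≃* ((Fin 2 → L) ≃ₗ[L] (Fin 2 → L)) :=
  (Matrix.GeneralLinearGroup.toLin).trans
    (LinearMap.GeneralLinearGroup.generalLinearEquiv L (Fin 2 → L))

theorem glMulEquiv_apply (L : Type*) [Field L] (g : GL (Fin 2) L) (v : Fin 2 → L) :
    glMulEquiv L g v = (g : Matrix (Fin 2) (Fin 2) L).mulVec v := by
  simp [glMulEquiv]

/-- The action of `GL₂(L)` on the projective line `P¹(L)`, given in homogeneous
coordinates by `[a : b] ↦ [α a + β b : γ a + δ b]`. -/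
noncomputable def glP1 (L : Type*) [Field L] :
    GL (Fin 2) L →* Function.End (Projectivization L (Fin 2 → L)) where
  toFun g := Projectivization.map (glMulEquiv L g).toLinearMap (glMulEquiv L g).injective
  map_one' := by
    funext x
    induction x using Projectivization.ind with
    | h v hv =>
      show Projectivization.map (glMulEquiv L 1).toLinearMap (glMulEquiv L 1).injective
          (Projectivization.mk L v hv) = Projectivization.mk L v hv
      rw [Projectivization.map_mk, Projectivization.mk_eq_mk_iff']
      exact ⟨1, by simp [glMulEquiv_apply]⟩
  map_mul' g h := by
    funext x
    induction x using Projectivization.ind with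
    | h v hv =>
      show Projectivization.map (glMulEquiv L (g * h)).toLinearMap
          (glMulEquiv L (g * h)).injective (Projectivization.mk L v hv)
        = Projectivization.map (glMulEquiv L g).toLinearMap (glMulEquiv L g).injective
            (Projectivization.map (glMulEquiv L h).toLinearMap (glMulEquiv L h).injective
              (Projectivization.mk L v hv))
      rw [Projectivization.map_mk, Projectivization.map_mk, Projectivization.map_mk,
        Projectivization.mk_eq_mk_iff']
      exact ⟨1, by simp [glMulEquiv_apply, Matrix.mulVec_mulVec]⟩

/-- The action of `GL₂(L)` on `P¹(L)` as a `MulAction`. -/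
noncomputable instance glP1Action (L : Type*) [Field L] :
    MulAction (GL (Fin 2) L) (Projectivization L (Fin 2 → L)) :=
  MulAction.ofEndHom (glP1 L)

/-- The subgroup of scalar matrices inside `GL₂(L)`. -/
def scalarSubgroup (L : Type*) [Field L] : Subgroup (GL (Fin 2) L) :=
  (Units.map ((Matrix.scalar (Fin 2)) : L →+* Matrix (Fin 2) (Fin 2) L).toMonoidHom).range

instance scalarSubgroup_normal (L : Type*) [Field L] : (scalarSubgroup L).Normal := by
  constructor
  rintro n ⟨a, rfl⟩ g
  refine ⟨a, ?_⟩
  have hc : Commute (Units.map ((Matrix.scalar (Fin 2)) :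
      L →+* Matrix (Fin 2) (Fin 2) L).toMonoidHom a) g := by
    apply Units.ext
    simpa using (Matrix.scalar_commute (a : L) (fun r => mul_comm _ _)
      (g : Matrix (Fin 2) (Fin 2) L)).eq
  rw [← hc.eq, mul_assoc, mul_inv_cancel, mul_one]

/-- `PGL₂(K)`: the quotient of `GL₂(K)` by the subgroup of scalar matrices. -/
abbrev PGL2 (K : Type*) [Field K] := GL (Fin 2) K ⧸ scalarSubgroup K

/-- Scalar matrices act trivially on the projective line. -/
theorem glP1_scalar_eq_one (L : Type*) [Field L] (a : Lˣ) :
    glP1 L (Units.map ((Matrix.scalar (Fin 2)) :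
      L →+* Matrix (Fin 2) (Fin 2) L).toMonoidHom a) = 1 := by
  set u := Units.map ((Matrix.scalar (Fin 2)) :
      L →+* Matrix (Fin 2) (Fin 2) L).toMonoidHom a with hu
  funext x
  induction x using Projectivization.ind with
  | h v hv =>
    show Projectivization.map (glMulEquiv L u).toLinearMap (glMulEquiv L u).injective
        (Projectivization.mk L v hv) = Projectivization.mk L v hv
    rw [Projectivization.map_mk, Projectivization.mk_eq_mk_iff']
    refine ⟨(a : L), ?_⟩
    simp [glMulEquiv_apply, hu, Matrix.scalar_apply, Matrix.diagonal_const_mulVec]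

/-- For a field homomorphism `f : K →+* L`, the scalar matrices of `GL₂(K)` act trivially on
`P¹(L)`, hence the action of `GL₂(K)` on `P¹(L)` descends to an action of `PGL₂(K)`. -/
noncomputable def pglP1 {K L : Type*} [Field K] [Field L] (f : K →+* L) :
    PGL2 K →* Function.End (Projectivization L (Fin 2 → L)) :=
  QuotientGroup.lift (scalarSubgroup K)
    ((glP1 L).comp (Matrix.GeneralLinearGroup.map f))
    (by
      rintro z ⟨a, rfl⟩
      have key : Matrix.GeneralLinearGroup.map (n := Fin 2) f
          (Units.map ((Matrix.scalar (Fin 2)) : K →+* Matrix (Fin 2) (Fin 2) K).toMonoidHom a)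
          = Units.map ((Matrix.scalar (Fin 2)) :
              L →+* Matrix (Fin 2) (Fin 2) L).toMonoidHom (Units.map f.toMonoidHom a) := by
        apply Units.ext
        ext i j
        simp [Matrix.GeneralLinearGroup.map, Matrix.scalar_apply, Matrix.diagonal,
          Matrix.map_apply, apply_ite f]
      rw [MonoidHom.mem_ker, MonoidHom.comp_apply, key, glP1_scalar_eq_one])

/-- The action of `PGL₂(K)` on `P¹(L)`, for any extension `L` of `K` via `f : K →+* L`. -/
noncomputable def pglP1Action {K L : Type*} [Field K] [Field L] (f : K →+* L) :
    MulAction (PGL2 K) (Projectivization L (Fin 2 → L)) :=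
  MulAction.ofEndHom (pglP1 f)
/-- The Frobenius map on the projective line `P¹(L)`, acting in homogeneous coordinates by
`[a : b] ↦ [a ^ q : b ^ q]`. -/
noncomputable def frobP1 {L : Type*} [Field L] (q : ℕ)
    (x : Projectivization L (Fin 2 → L)) : Projectivization L (Fin 2 → L) :=
  Projectivization.mk L (fun i => (x.rep i) ^ q) (by
    intro hzero
    obtain ⟨i, hi⟩ := Function.ne_iff.mp x.rep_nonzero
    have h2 : x.rep i ^ q = 0 := congrFun hzero i
    exact hi (by simpa using (pow_eq_zero_iff'.mp h2).1))

noncomputable instance pglP1ClosureAction (K : Type*) [Field K] :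
    MulAction (PGL2 K)
      (Projectivization (AlgebraicClosure K) (Fin 2 → AlgebraicClosure K)) :=
  pglP1Action (algebraMap K (AlgebraicClosure K))

namespace FrobeniusTuples

section Frobenius

variable {L : Type*} [Field L]

theorem pow_ne_zero_fun {v : Fin 2 → L} (hv : v ≠ 0) (q : ℕ) : (fun i => v i ^ q) ≠ 0 := by
  obtain ⟨i, hi⟩ := Function.ne_iff.mp hv
  exact Function.ne_iff.mpr ⟨i, pow_ne_zero q hi⟩

theorem frobP1_mk (q : ℕ) (v : Fin 2 → L) (hv : v ≠ 0) :
    frobP1 q (mk L v hv) = mk L (fun i => v i ^ q) (pow_ne_zero_fun hv q) := by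
  obtain ⟨a, ha⟩ := exists_smul_eq_mk_rep L v hv
  rw [frobP1, mk_eq_mk_iff']
  refine ⟨(a : L) ^ q, funext fun i => ?_⟩
  simp [← ha, Units.smul_def, mul_pow]

/-- The point `[a : 1]` of the projective line. -/
noncomputable def affinePoint (a : L) : Projectivization L (Fin 2 → L) :=
  mk L ![a, 1] fun h => one_ne_zero (congrFun h 1)

/-- The point `[1 : 0]` of the projective line. -/
noncomputable def infinityPoint (L : Type*) [Field L] : Projectivization L (Fin 2 → L) :=
  mk L ![1, 0] fun h => one_ne_zero (congrFun h 0)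

theorem affinePoint_injective : Function.Injective (affinePoint : L → _) := by
  intro a b h
  obtain ⟨c, hc⟩ := (mk_eq_mk_iff' ..).mp h
  have h0 := congrFun hc 0
  have h1 := congrFun hc 1
  simp only [Pi.smul_apply, smul_eq_mul, Matrix.cons_val_zero, Matrix.cons_val_one] at h0 h1
  rw [← h0, show c = 1 by simpa using h1, one_mul]

theorem affinePoint_ne_infinityPoint (a : L) : affinePoint a ≠ infinityPoint L := by
  intro h
  obtain ⟨c, hc⟩ := (mk_eq_mk_iff' ..).mp h
  simpa using congrFun hc 1

theorem exists_affinePoint_eq {x : Projectivization L (Fin 2 → L)} (hx : x ≠ infinityPoint L) :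
    ∃ a, x = affinePoint a := by
  induction x using Projectivization.ind with
  | h v hv =>
    have hv1 : v 1 ≠ 0 := by
      intro h1
      refine hx ((mk_eq_mk_iff' ..).mpr ⟨v 0, funext fun i => ?_⟩)
      fin_cases i <;> simp [h1]
    refine ⟨v 0 / v 1, (mk_eq_mk_iff' ..).mpr ⟨v 1, funext fun i => ?_⟩⟩
    fin_cases i <;> simp [mul_div_cancel₀, hv1]

theorem frobP1_affinePoint (q : ℕ) (a : L) : frobP1 q (affinePoint a) = affinePoint (a ^ q) := by
  rw [affinePoint, frobP1_mk, affinePoint, mk_eq_mk_iff']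
  refine ⟨1, funext fun i => ?_⟩
  fin_cases i <;> simp

theorem frobP1_infinityPoint {q : ℕ} (hq : q ≠ 0) :
    frobP1 q (infinityPoint L) = infinityPoint L := by
  rw [infinityPoint, frobP1_mk, mk_eq_mk_iff']
  refine ⟨1, funext fun i => ?_⟩
  fin_cases i <;> simp [hq]

/-- The tuple `([a : 1], [a ^ q : 1], [1 : 0], [0 : 1])`. -/
noncomputable def standardTuple (q : ℕ) (a : L) : Fin 4 → Projectivization L (Fin 2 → L) :=
  ![affinePoint a, affinePoint (a ^ q), infinityPoint L, affinePoint 0]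

theorem standardTuple_injective {q : ℕ} {a : L} (ha : a ≠ 0) (haq : a ^ q ≠ a) :
    Function.Injective (standardTuple q a) := by
  have h1 := affinePoint_injective.ne haq
  have h2 := affinePoint_injective.ne ha
  have h3 := affinePoint_injective.ne (pow_ne_zero q ha)
  intro i j
  fin_cases i <;> fin_cases j <;>
    simp [standardTuple, affinePoint_ne_infinityPoint, (affinePoint_ne_infinityPoint _).symm,
      h1, h1.symm, h2, h2.symm, h3, h3.symm]

end Frobenius

section FiniteField

variable {K : Type*} [Field K] [Fintype K]

theorem mem_range_algebraMap_of_pow_card_eq {L : Type*} [Field L] [Algebra K L] {b : L}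
    (hb : b ^ Fintype.card K = b) : b ∈ Set.range (algebraMap K L) := by
  have hsplit := Polynomial.splits_X_pow_nat_card_sub_X (K := K)
  rw [Nat.card_eq_fintype_card] at hsplit
  exact hsplit.mem_range_of_isRoot (FiniteField.X_pow_card_sub_X_ne_zero K Fintype.one_lt_card)
    (by simp [hb])

theorem card_nthRootsFinset_card_add_one (L : Type*) [Field L] [Algebra K L] [IsAlgClosed L] :
    (Polynomial.nthRootsFinset (Fintype.card K + 1) (1 : L)).card = Fintype.card K + 1 := by
  have : NeZero ((Fintype.card K + 1 : ℕ) : L) := ⟨by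
    have h := congrArg (algebraMap K L) (FiniteField.cast_card_eq_zero K)
    rw [map_natCast, map_zero] at h
    simp [h]⟩
  have : NeZero (Fintype.card K + 1) := ⟨by simp⟩
  obtain ⟨ζ, hζ⟩ := HasEnoughRootsOfUnity.exists_primitiveRoot L (Fintype.card K + 1)
  exact hζ.card_nthRootsFinset

theorem exists_mk_eq_of_frobP1_eq {L : Type*} [Field L] [Algebra K L]
    {x : Projectivization L (Fin 2 → L)} (hx : frobP1 (Fintype.card K) x = x) :
    ∃ (w : Fin 2 → K) (hw : (fun i => algebraMap K L (w i)) ≠ 0), x = mk L _ hw := by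
  induction x using Projectivization.ind with
  | h v hv =>
    obtain ⟨i, hi⟩ := Function.ne_iff.mp hv
    replace hi : v i ≠ 0 := hi
    obtain ⟨c, hc⟩ := (mk_eq_mk_iff' ..).mp ((frobP1_mk ..).symm.trans hx)
    have hc' (j) : c * v j = v j ^ Fintype.card K := congrFun hc j
    have hc0 : c ≠ 0 := by
      rintro rfl
      exact pow_ne_zero (Fintype.card K) hi (by rw [← hc', zero_mul])
    have hrat (j) : ∃ b : K, algebraMap K L b = v j / v i := by
      apply mem_range_algebraMap_of_pow_card_eq
      rw [div_pow, ← hc', ← hc', mul_div_mul_left _ _ hc0]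
    choose w hw using hrat
    refine ⟨w, Function.ne_iff.mpr ⟨i, by simp [hw, hi]⟩,
      (mk_eq_mk_iff' ..).mpr ⟨v i, funext fun j => ?_⟩⟩
    simp [hw, mul_div_cancel₀, hi]

end FiniteField

section Action

variable {K : Type*} [Field K]

local notation "L" => AlgebraicClosure K

theorem mulVec_map_ne_zero (g : GL (Fin 2) K) {v : Fin 2 → L} (hv : v ≠ 0) :
    ((g : Matrix (Fin 2) (Fin 2) K).map (algebraMap K L)).mulVec v ≠ 0 := by
  have h := (glMulEquiv L (Matrix.GeneralLinearGroup.map (algebraMap K L) g)).map_ne_zero_iff.mpr hv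
  rwa [glMulEquiv_apply] at h

theorem coe_smul_mk (g : GL (Fin 2) K) (v : Fin 2 → L) (hv : v ≠ 0) :
    (g : PGL2 K) • mk L v hv =
      mk L (((g : Matrix (Fin 2) (Fin 2) K).map (algebraMap K L)).mulVec v)
        (mulVec_map_ne_zero g hv) := by
  change mk L (glMulEquiv L (Matrix.GeneralLinearGroup.map (algebraMap K L) g) v) _ = _
  simp only [glMulEquiv_apply]
  rfl

theorem frobP1_smul [Fintype K] (g : PGL2 K) (x : Projectivization L (Fin 2 → L)) :
    frobP1 (Fintype.card K) (g • x) = g • frobP1 (Fintype.card K) x := by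
  induction g using QuotientGroup.induction_on with
  | H g =>
    induction x using Projectivization.ind with
    | h v hv =>
      rw [coe_smul_mk, frobP1_mk, frobP1_mk, coe_smul_mk, mk_eq_mk_iff']
      refine ⟨1, funext fun i => ?_⟩
      have h := map_add (FiniteField.frobeniusAlgHom K L)
      simp only [FiniteField.coe_frobeniusAlgHom] at h
      fin_cases i <;> simp [Matrix.mulVec, dotProduct, Fin.sum_univ_two, h, mul_pow, ← map_pow,
        FiniteField.pow_card]

/-- A projectivity that fixes `[1 : 0]` and `[0 : 1]` scales the affine coordinate. -/
theorem exists_eq_mul_of_smul_affinePoint {g : PGL2 K}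
    (hinf : g • infinityPoint L = infinityPoint L)
    (hzero : g • affinePoint (0 : L) = affinePoint 0) :
    ∃ c : K, c ≠ 0 ∧ ∀ a : L, g • affinePoint a = affinePoint (algebraMap K L c * a) := by
  induction g using QuotientGroup.induction_on with
  | H g =>
    obtain ⟨s, hs⟩ := (mk_eq_mk_iff' ..).mp ((coe_smul_mk ..).symm.trans hinf)
    obtain ⟨t, ht⟩ := (mk_eq_mk_iff' ..).mp ((coe_smul_mk ..).symm.trans hzero)
    have h10 : (g : Matrix (Fin 2) (Fin 2) K) 1 0 = 0 := by
      simpa [Matrix.mulVec, dotProduct, Fin.sum_univ_two] using (congrFun hs 1).symm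
    have h01 : (g : Matrix (Fin 2) (Fin 2) K) 0 1 = 0 := by
      simpa [Matrix.mulVec, dotProduct, Fin.sum_univ_two] using (congrFun ht 0).symm
    have hdet := g.det_ne_zero
    rw [Matrix.det_fin_two, h10, h01, mul_zero, sub_zero, mul_ne_zero_iff] at hdet
    obtain ⟨h00, h11⟩ := hdet
    refine ⟨g 0 0 / g 1 1, div_ne_zero h00 h11, fun a => ?_⟩
    rw [affinePoint, coe_smul_mk, affinePoint, mk_eq_mk_iff']
    refine ⟨algebraMap K L (g 1 1), funext fun i => ?_⟩
    have h11' : algebraMap K L (g 1 1) ≠ 0 := by simpa using h11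
    fin_cases i
    · simp [Matrix.mulVec, dotProduct, Fin.sum_univ_two, h01]
      field_simp
    · simp [Matrix.mulVec, dotProduct, Fin.sum_univ_two, h10]

theorem exists_smul_affinePoint_eq {c : K} (hc : c ≠ 0) :
    ∃ g : PGL2 K, g • infinityPoint L = infinityPoint L ∧
      ∀ a : L, g • affinePoint a = affinePoint (algebraMap K L c * a) := by
  refine ⟨(Matrix.GeneralLinearGroup.mkOfDetNeZero !![c, 0; 0, 1] (by simpa) : GL (Fin 2) K),
    ?_, fun a => ?_⟩
  · rw [infinityPoint, coe_smul_mk, mk_eq_mk_iff']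
    refine ⟨algebraMap K L c, funext fun i => ?_⟩
    fin_cases i <;> simp [Matrix.mulVec, dotProduct, Fin.sum_univ_two,
      Matrix.GeneralLinearGroup.mkOfDetNeZero]
  · rw [affinePoint, coe_smul_mk, affinePoint, mk_eq_mk_iff']
    refine ⟨1, funext fun i => ?_⟩
    fin_cases i <;> simp [Matrix.mulVec, dotProduct, Fin.sum_univ_two,
      Matrix.GeneralLinearGroup.mkOfDetNeZero]

/-- Two distinct rational points can be moved to `[1 : 0]` and `[0 : 1]`. -/
theorem exists_smul_eq_infinityPoint_and_zero [Fintype K] {x y : Projectivization L (Fin 2 → L)}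
    (hx : frobP1 (Fintype.card K) x = x) (hy : frobP1 (Fintype.card K) y = y) (hxy : x ≠ y) :
    ∃ g : PGL2 K, g • x = infinityPoint L ∧ g • y = affinePoint 0 := by
  obtain ⟨v, hv, rfl⟩ := exists_mk_eq_of_frobP1_eq hx
  obtain ⟨w, hw, rfl⟩ := exists_mk_eq_of_frobP1_eq hy
  have hdet : Matrix.det !![v 0, w 0; v 1, w 1] ≠ 0 := by
    rw [Matrix.det_fin_two_of]
    intro h
    have hL := congrArg (algebraMap K L) h
    simp only [map_sub, map_mul, map_zero] at hL
    obtain ⟨i, hi⟩ := Function.ne_iff.mp hw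
    replace hi : algebraMap K L (w i) ≠ 0 := hi
    refine hxy ((mk_eq_mk_iff' ..).mpr
      ⟨algebraMap K L (v i) / algebraMap K L (w i), funext fun j => ?_⟩)
    simp only [Pi.smul_apply, smul_eq_mul]
    rw [div_mul_eq_mul_div, div_eq_iff hi]
    fin_cases i <;> fin_cases j <;> simp only [Fin.zero_eta, Fin.mk_one] <;>
      first | ring1 | linear_combination hL | linear_combination -hL
  set g : GL (Fin 2) K := Matrix.GeneralLinearGroup.mkOfDetNeZero _ hdet with hg
  refine ⟨(g : PGL2 K)⁻¹, inv_smul_eq_iff.mpr ?_, inv_smul_eq_iff.mpr ?_⟩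
  all_goals
    simp only [infinityPoint, affinePoint, coe_smul_mk]
    refine (mk_eq_mk_iff' ..).mpr ⟨1, funext fun i => ?_⟩
    fin_cases i <;> simp [hg, Matrix.GeneralLinearGroup.mkOfDetNeZero]

/-- Every tuple with the prescribed Frobenius action can be moved to a standard one. -/
theorem exists_smul_eq_standardTuple [Fintype K]
    {x : Fin 4 → Projectivization L (Fin 2 → L)} (hx : Function.Injective x)
    (h0 : frobP1 (Fintype.card K) (x 0) = x 1) (h1 : frobP1 (Fintype.card K) (x 1) = x 0)
    (h2 : frobP1 (Fintype.card K) (x 2) = x 2) (h3 : frobP1 (Fintype.card K) (x 3) = x 3) :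
    ∃ (g : PGL2 K) (a : L), a ≠ 0 ∧ a ^ Fintype.card K ≠ a ∧
      (a ^ Fintype.card K) ^ Fintype.card K = a ∧ g • x = standardTuple (Fintype.card K) a := by
  obtain ⟨g, hg2, hg3⟩ := exists_smul_eq_infinityPoint_and_zero h2 h3 (hx.ne (by decide))
  have hgx {i j : Fin 4} (hij : i ≠ j) : g • x i ≠ g • x j :=
    (MulAction.injective g).ne (hx.ne hij)
  obtain ⟨a, ha⟩ := exists_affinePoint_eq (hg2 ▸ hgx (show (0 : Fin 4) ≠ 2 by decide))
  have hg1 : g • x 1 = affinePoint (a ^ Fintype.card K) := by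
    rw [← h0, ← frobP1_smul, ha, frobP1_affinePoint]
  refine ⟨g, a, ?_, ?_, ?_, ?_⟩
  · rintro rfl
    exact hgx (show (0 : Fin 4) ≠ 3 by decide) (ha.trans hg3.symm)
  · intro h
    exact hgx (show (0 : Fin 4) ≠ 1 by decide) (by rw [ha, hg1, h])
  · apply affinePoint_injective
    rw [← frobP1_affinePoint, ← hg1, frobP1_smul, h1, ha]
  · funext i
    fin_cases i
    exacts [ha, hg1, hg2, hg3]

/-- The quantity `a ^ (q - 1)` is a complete invariant of the orbit of a standard tuple. -/
theorem exists_smul_standardTuple_eq_iff [Fintype K] {a b : L} (ha : a ≠ 0) (hb : b ≠ 0) :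
    (∃ g : PGL2 K, g • standardTuple (Fintype.card K) a = standardTuple (Fintype.card K) b) ↔
      a ^ Fintype.card K / a = b ^ Fintype.card K / b := by
  rw [div_eq_div_iff ha hb]
  constructor
  · rintro ⟨g, hg⟩
    obtain ⟨c, -, hgc⟩ := exists_eq_mul_of_smul_affinePoint (congrFun hg 2) (congrFun hg 3)
    obtain rfl := affinePoint_injective ((hgc a).symm.trans (congrFun hg 0))
    rw [mul_pow, ← map_pow, FiniteField.pow_card]
    ring
  · intro h
    obtain ⟨c, hc⟩ := mem_range_algebraMap_of_pow_card_eq (K := K) (b := b / a) (by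
      rw [div_pow, div_eq_div_iff (pow_ne_zero _ ha) ha, ← h, mul_comm])
    have hc0 : c ≠ 0 := by
      rintro rfl
      exact div_ne_zero hb ha (by rw [← hc, map_zero])
    obtain rfl : b = algebraMap K L c * a := by rw [hc, div_mul_cancel₀ _ ha]
    obtain ⟨g, hinf, hg⟩ := exists_smul_affinePoint_eq hc0
    refine ⟨g, funext fun i => ?_⟩
    fin_cases i
    · exact hg a
    · refine (hg _).trans (congrArg affinePoint ?_)
      rw [mul_pow, ← map_pow, FiniteField.pow_card]
    · exact hinf
    · exact (hg 0).trans (congrArg affinePoint (mul_zero _))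

end Action

end FrobeniusTuples

open FrobeniusTuples

/-- the number of `PGL₂(K)`-orbits of injective 4-tuples on `P¹(K̄)`
satisfying the stated Frobenius conditions. -/
theorem statement1 (q : ℕ) (hq : IsPrimePow q)
    (K : Type*) [Field K] [Fintype K] (hK : Fintype.card K = q) :
    (Nat.card (Quotient (Setoid.comap
      (Subtype.val :
        {x : Fin 4 → Projectivization (AlgebraicClosure K) (Fin 2 → AlgebraicClosure K) //
          Function.Injective x ∧
          frobP1 q (x 0) = x 1 ∧
          frobP1 q (x 1) = x 0 ∧
          frobP1 q (x 2) = x 2 ∧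
          frobP1 q (x 3) = x 3} →
        (Fin 4 → Projectivization (AlgebraicClosure K) (Fin 2 → AlgebraicClosure K)))
      (MulAction.orbitRel (PGL2 K)
        (Fin 4 → Projectivization (AlgebraicClosure K) (Fin 2 → AlgebraicClosure K))))) : ℤ)
    = (q : ℤ) := by
  classical
  subst hK
  have hq1 : 1 < Fintype.card K := Fintype.one_lt_card
  let U := (Polynomial.nthRootsFinset (Fintype.card K + 1) (1 : AlgebraicClosure K)).erase 1
  have hU (u : AlgebraicClosure K) : u ∈ U ↔ u ≠ 1 ∧ u ^ (Fintype.card K + 1) = 1 := by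
    simp [U, Polynomial.mem_nthRootsFinset]
  have hroot (u : U) : ∃ a : AlgebraicClosure K, a ≠ 0 ∧ a ^ Fintype.card K / a = u := by
    obtain ⟨a, ha⟩ := IsAlgClosed.exists_pow_nat_eq (u : AlgebraicClosure K)
      (Nat.sub_pos_of_lt hq1)
    have ha0 : a ≠ 0 := by
      rintro rfl
      have hu := ((hU u).mp u.2).2
      rw [← ha, zero_pow (Nat.sub_pos_of_lt hq1).ne', zero_pow (by simp)] at hu
      exact zero_ne_one hu
    refine ⟨a, ha0, ?_⟩
    rw [div_eq_iff ha0, ← ha, ← pow_succ, Nat.sub_add_cancel hq1.le]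
  choose a ha0 hau using hroot
  have hpow (u : U) : a u ^ Fintype.card K = u * a u := by
    rw [← hau, div_mul_cancel₀ _ (ha0 u)]
  let T (u : U) : {x : Fin 4 → Projectivization (AlgebraicClosure K) (Fin 2 → AlgebraicClosure K) //
      Function.Injective x ∧ frobP1 (Fintype.card K) (x 0) = x 1 ∧
      frobP1 (Fintype.card K) (x 1) = x 0 ∧ frobP1 (Fintype.card K) (x 2) = x 2 ∧
      frobP1 (Fintype.card K) (x 3) = x 3} :=
    ⟨standardTuple (Fintype.card K) (a u), by
      obtain ⟨hu1, hu⟩ := (hU u).mp u.2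
      refine ⟨standardTuple_injective (ha0 u) ?_, frobP1_affinePoint _ _,
        (frobP1_affinePoint _ _).trans (congrArg affinePoint ?_),
        frobP1_infinityPoint Fintype.card_ne_zero,
        (frobP1_affinePoint _ _).trans (congrArg affinePoint (zero_pow Fintype.card_ne_zero))⟩
      · rw [hpow]
        simpa [ha0 u] using hu1
      · rw [hpow, mul_pow, hpow, ← mul_assoc, ← pow_succ, hu, one_mul]⟩
  have hcard : Nat.card U = Fintype.card K := by
    rw [Nat.subtype_card U fun _ => Iff.rfl, Finset.card_erase_of_mem (by simp [Polynomial.mem_nthRootsFinset]),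
      card_nthRootsFinset_card_add_one, Nat.add_sub_cancel]
  refine congrArg Nat.cast (Eq.trans (Eq.symm ?_) hcard)
  refine Nat.card_congr (Equiv.ofBijective (fun u => Quotient.mk _ (T u)) ⟨?_, ?_⟩)
  · intro u v huv
    have h := (exists_smul_standardTuple_eq_iff (ha0 v) (ha0 u)).mp (Quotient.exact huv)
    rw [hau, hau] at h
    exact Subtype.ext h.symm
  · refine Quotient.ind ?_
    rintro ⟨x, hx, h0, h1, h2, h3⟩
    obtain ⟨g, b, hb0, hb1, hb2, hgx⟩ := exists_smul_eq_standardTuple hx h0 h1 h2 h3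
    have hbU : b ^ Fintype.card K / b ∈ U := by
      refine (hU _).mpr ⟨by rwa [Ne, div_eq_one_iff_eq hb0], ?_⟩
      rw [pow_succ, div_pow, hb2]
      field_simp
    obtain ⟨k, hk⟩ := (exists_smul_standardTuple_eq_iff hb0 (ha0 ⟨_, hbU⟩)).mpr (hau ⟨_, hbU⟩).symm
    refine ⟨⟨_, hbU⟩, Quotient.sound ⟨k * g, ?_⟩⟩
    change (k * g) • x = standardTuple _ _
    rw [mul_smul, hgx, hk]
end

section
/- Let q be a prime power, K a finite field with q elements, K̄ an algebraic closure of K, and φ the Frobenius map on P¹(K̄) given by [a : b] ↦ [a^q : b^q]. The number of orbits of the componentwise action of PGL₂(K) on the set of ordered 4-tuples (x₁, x₂, x₃, x₄) of pairwise distinct points of P¹(K̄) satisfying φ(x₁) = x₂, φ(x₂) = x₃, φ(x₃) = x₁ and φ(x₄) = x₄ equals q + 1. -/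
open Projectivization

section Frobenius

variable {K L : Type*} [Field K] [Fintype K] [Field L] [Algebra K L]

open Polynomial in
theorem ncard_pow_eq_self_le {n : ℕ} (hn : 1 < n) :
    {t : L | t ^ n = t}.Finite ∧ {t : L | t ^ n = t}.ncard ≤ n := by
  classical
  have h0 := FiniteField.X_pow_card_sub_X_ne_zero L hn
  have h : {t : L | t ^ n = t} = ((X ^ n - X : L[X]).roots.toFinset : Set L) := by
    ext t
    simp [h0, sub_eq_zero]
  rw [h, Set.ncard_coe_finset]
  refine ⟨Finset.finite_toSet _, (Multiset.toFinset_card_le _).trans ((card_roots' _).trans ?_)⟩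
  rw [FiniteField.X_pow_card_sub_X_natDegree_eq L hn]

open Polynomial in
theorem ncard_pow_eq_self [IsAlgClosed L] {n : ℕ} (hn : 1 < n) (hc : (n : L) = 0) :
    {t : L | t ^ n = t}.ncard = n := by
  have h0 := FiniteField.X_pow_card_sub_X_ne_zero L hn
  have h : {t : L | t ^ n = t} = (X ^ n - X : L[X]).rootSet L := by
    ext t
    simp [mem_rootSet, h0, sub_eq_zero]
  have hsep : (X ^ n - X : L[X]).Separable :=
    galois_poly_separable (ringChar L) n ((ringChar.spec L n).1 hc)
  rw [h, ← Nat.card_coe_set_eq, Nat.card_eq_fintype_card,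
    card_rootSet_eq_natDegree hsep (IsAlgClosed.splits _),
    FiniteField.X_pow_card_sub_X_natDegree_eq L hn]

/-- The elements of `L` fixed by the `q`-power map, `q = #K`, are those of `K`. -/
theorem pow_card_eq_self_iff (t : L) :
    t ^ Fintype.card K = t ↔ ∃ k : K, algebraMap K L k = t := by
  have hn : 1 < Fintype.card K := Fintype.one_lt_card
  obtain ⟨hfin, hcard⟩ := ncard_pow_eq_self_le (L := L) hn
  have hsub : Set.range (algebraMap K L) ⊆ {t : L | t ^ Fintype.card K = t} := by
    rintro _ ⟨k, rfl⟩
    simp [← map_pow, FiniteField.pow_card]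
  have hrange : (Set.range (algebraMap K L)).ncard = Fintype.card K := by
    rw [← Set.image_univ, Set.ncard_image_of_injective _ (algebraMap K L).injective,
      Set.ncard_univ, Nat.card_eq_fintype_card]
  have := Set.eq_of_subset_of_ncard_le hsub (hcard.trans hrange.ge) hfin
  exact (Set.ext_iff.1 this t).symm

theorem exists_pow_pow_pow_card_eq_self [IsAlgClosed L] :
    ∃ t : L, t ^ Fintype.card K ≠ t ∧
      ((t ^ Fintype.card K) ^ Fintype.card K) ^ Fintype.card K = t := by
  set q := Fintype.card K with hq
  have hn : 1 < q := Fintype.one_lt_card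
  have hn3 : 1 < q ^ 3 := Nat.one_lt_pow (by norm_num) hn
  have hq0 : (q : L) = 0 := by
    rw [← map_natCast (algebraMap K L), FiniteField.cast_card_eq_zero, map_zero]
  have h3 : {t : L | t ^ q ^ 3 = t}.ncard = q ^ 3 :=
    ncard_pow_eq_self hn3 (by simp [hq0])
  obtain ⟨hfin, h1⟩ := ncard_pow_eq_self_le (L := L) hn
  have hlt : q < q ^ 3 := lt_self_pow₀ hn (by norm_num)
  obtain ⟨t, ht3, ht1⟩ := Set.exists_mem_notMem_of_ncard_lt_ncard
    (h1.trans_lt (hlt.trans_eq h3.symm)) hfin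
  refine ⟨t, ht1, ?_⟩
  rw [← pow_mul, ← pow_mul, ← pow_two, ← pow_succ']
  exact ht3

variable {s t : L}

/-- An element of degree three over `K` satisfies no nonzero quadratic equation over `K`. -/
theorem quadratic_coeff_eq_zero (ht : t ^ Fintype.card K ≠ t)
    (ht3 : ((t ^ Fintype.card K) ^ Fintype.card K) ^ Fintype.card K = t) {a b c : K}
    (h : algebraMap K L a * t ^ 2 + algebraMap K L b * t + algebraMap K L c = 0) :
    a = 0 ∧ b = 0 ∧ c = 0 := by
  set F := FiniteField.frobeniusAlgHom K L
  have hF (x : L) : x ^ Fintype.card K = F x := rfl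
  simp only [hF] at ht ht3
  have h1 := congrArg F h
  have h2 := congrArg F h1
  simp only [map_add, map_mul, map_pow, AlgHom.commutes, map_zero] at h1 h2
  have h01 : F t - t ≠ 0 := sub_ne_zero.2 ht
  have h12 : F (F t) - F t ≠ 0 := sub_ne_zero.2 fun e ↦ ht (F.injective e)
  have h02 : F (F t) - t ≠ 0 := sub_ne_zero.2 fun e ↦ by
    rw [e] at ht3
    exact ht ht3
  have e1 : algebraMap K L a * (F t + t) + algebraMap K L b = 0 :=
    mul_left_cancel₀ h01 (by linear_combination h1 - h)
  have e2 : algebraMap K L a * (F (F t) + F t) + algebraMap K L b = 0 :=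
    mul_left_cancel₀ h12 (by linear_combination h2 - h1)
  have ha : algebraMap K L a = 0 := mul_left_cancel₀ h02 (by linear_combination e2 - e1)
  have hb : algebraMap K L b = 0 := by simpa [ha] using e1
  have hc : algebraMap K L c = 0 := by simpa [ha, hb] using h
  simpa using And.intro ha (And.intro hb hc)

/-- Four elements of the cubic extension of `K` are linearly dependent over `K`; applied to
`s`, `1`, `t * s`, `t`. -/
theorem exists_bilinear_relation
    (hs3 : ((s ^ Fintype.card K) ^ Fintype.card K) ^ Fintype.card K = s)
    (ht3 : ((t ^ Fintype.card K) ^ Fintype.card K) ^ Fintype.card K = t) :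
    ∃ v : Fin 4 → K, v ≠ 0 ∧
      algebraMap K L (v 0) * s + algebraMap K L (v 1)
        = t * (algebraMap K L (v 2) * s + algebraMap K L (v 3)) := by
  set q := Fintype.card K with hq
  have hn : 1 < q := Fintype.one_lt_card
  have hn3 : 1 < q ^ 3 := Nat.one_lt_pow (by norm_num) hn
  let f : (Fin 4 → K) → L := fun v ↦ algebraMap K L (v 0) * s + algebraMap K L (v 1)
    - t * (algebraMap K L (v 2) * s + algebraMap K L (v 3))
  set F := FiniteField.frobeniusAlgHom K L
  have hF (x : L) : x ^ q = F x := rfl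
  simp only [hF] at hs3 ht3
  have hf (v : Fin 4 → K) : f v ∈ {x : L | x ^ q ^ 3 = x} := by
    have : f v ^ q ^ 3 = F (F (F (f v))) := by
      simp only [← hF, ← pow_mul]
      ring_nf
    simp only [Set.mem_ofPred_eq, this, f, map_sub, map_add, map_mul, AlgHom.commutes, hs3, ht3]
  obtain ⟨hfin, hcard⟩ := ncard_pow_eq_self_le (L := L) hn3
  have hlt : {x : L | x ^ q ^ 3 = x}.ncard < (Set.univ : Set (Fin 4 → K)).ncard := by
    rw [Set.ncard_univ, Nat.card_eq_fintype_card, Fintype.card_fun, Fintype.card_fin]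
    exact hcard.trans_lt (Nat.pow_lt_pow_right hn (by norm_num))
  obtain ⟨u, -, v, -, huv, he⟩ :=
    Set.exists_ne_map_eq_of_ncard_lt_of_maps_to hlt (fun v _ ↦ hf v) hfin
  refine ⟨u - v, sub_ne_zero.2 huv, ?_⟩
  simp only [f] at he
  simp only [Pi.sub_apply, map_sub]
  linear_combination he

/-- `GL₂(K)` is transitive on the elements of degree three of `L`. -/
theorem exists_gl_mul_eq (hs : s ^ Fintype.card K ≠ s)
    (hs3 : ((s ^ Fintype.card K) ^ Fintype.card K) ^ Fintype.card K = s)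
    (ht : t ^ Fintype.card K ≠ t)
    (ht3 : ((t ^ Fintype.card K) ^ Fintype.card K) ^ Fintype.card K = t) :
    ∃ g : GL (Fin 2) K,
      algebraMap K L (g 0 0) * s + algebraMap K L (g 0 1)
        = t * (algebraMap K L (g 1 0) * s + algebraMap K L (g 1 1)) := by
  obtain ⟨v, hv, h⟩ := exists_bilinear_relation (K := K) hs3 ht3
  have hnot {a b : K} (x : L) (hx : x ^ Fintype.card K ≠ x)
      (h : algebraMap K L a * x + algebraMap K L b = 0) : a = 0 ∧ b = 0 := by
    have ha : a = 0 := by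
      by_contra ha
      refine hx ((pow_card_eq_self_iff (K := K) x).2 ⟨-b / a, ?_⟩)
      have : algebraMap K L a ≠ 0 := by simpa using ha
      simp only [map_div₀, map_neg]
      field_simp
      linear_combination -h
    refine ⟨ha, ?_⟩
    simpa [ha] using h
  have hdet : (!![v 0, v 1; v 2, v 3] : Matrix (Fin 2) (Fin 2) K).det ≠ 0 := by
    rw [Matrix.det_fin_two_of]
    intro hd
    have hd' : algebraMap K L (v 0) * algebraMap K L (v 3)
        = algebraMap K L (v 1) * algebraMap K L (v 2) := by
      rw [← map_mul, ← map_mul, sub_eq_zero.1 hd]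
    have hbot : v 2 = 0 ∧ v 3 = 0 := by
      by_contra hne
      have hz : algebraMap K L (v 2) * s + algebraMap K L (v 3) ≠ 0 :=
        fun e ↦ hne (hnot s hs e)
      have e2 : algebraMap K L (-v 2) * t + algebraMap K L (v 0) = 0 := by
        refine mul_left_cancel₀ hz ?_
        simp only [map_neg]
        linear_combination algebraMap K L (v 2) * h + hd'
      have e3 : algebraMap K L (-v 3) * t + algebraMap K L (v 1) = 0 := by
        refine mul_left_cancel₀ hz ?_
        simp only [map_neg]
        linear_combination algebraMap K L (v 3) * h - s * hd'
      exact hne ⟨by simpa using (hnot t ht e2).1, by simpa using (hnot t ht e3).1⟩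
    have htop : v 0 = 0 ∧ v 1 = 0 := hnot s hs (by simpa [hbot.1, hbot.2] using h)
    refine hv (funext fun i ↦ ?_)
    fin_cases i
    exacts [htop.1, htop.2, hbot.1, hbot.2]
  exact ⟨Matrix.GeneralLinearGroup.mkOfDetNeZero _ hdet, h⟩

end Frobenius

section ProjectiveLine

variable {L : Type*} [Field L]

/-- The identification of `P¹(L)` with `L ∪ {∞}`. -/
def optionP1 : Option L → Projectivization L (Fin 2 → L)
  | none => Projectivization.mk L ![1, 0] (by simp)
  | some t => Projectivization.mk L ![t, 1] (by simp)

theorem optionP1_injective : Function.Injective (optionP1 (L := L)) := by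
  rintro (_ | s) (_ | t) h
  · rfl
  all_goals
    obtain ⟨a, ha⟩ := (Projectivization.mk_eq_mk_iff' L _ _ _ _).1 h
    have h0 := congrFun ha 0
    have h1 := congrFun ha 1
    simp_all

theorem mk_eq_optionP1 (v : Fin 2 → L) (hv : v ≠ 0) (h : v 1 ≠ 0) :
    Projectivization.mk L v hv = optionP1 (some (v 0 / v 1)) := by
  refine (Projectivization.mk_eq_mk_iff' L _ _ _ _).2 ⟨v 1, ?_⟩
  ext i
  fin_cases i
  · simp [mul_div_cancel₀ _ h]
  · simp

theorem optionP1_surjective : Function.Surjective (optionP1 (L := L)) := by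
  intro x
  induction x using Projectivization.ind with
  | h v hv =>
    by_cases h : v 1 = 0
    · refine ⟨none, (Projectivization.mk_eq_mk_iff' L _ _ _ _).2 ⟨(v 0)⁻¹, ?_⟩⟩
      have h0 : v 0 ≠ 0 := fun h0 ↦ hv (funext fun i ↦ by fin_cases i <;> assumption)
      ext i
      fin_cases i <;> simp [h, h0]
    · exact ⟨_, (mk_eq_optionP1 v hv h).symm⟩

theorem frobP1_mk (q : ℕ) (v : Fin 2 → L) (hv : v ≠ 0) (hv' : (fun i ↦ v i ^ q) ≠ 0) :
    frobP1 q (Projectivization.mk L v hv) = Projectivization.mk L (fun i ↦ v i ^ q) hv' := by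
  obtain ⟨a, ha⟩ := Projectivization.exists_smul_eq_mk_rep L v hv
  refine (Projectivization.mk_eq_mk_iff' L _ _ _ _).2 ⟨(a : L) ^ q, ?_⟩
  ext i
  simp [← ha, Units.smul_def, mul_pow]

theorem frobP1_optionP1 {q : ℕ} (hq : q ≠ 0) (x : Option L) :
    frobP1 q (optionP1 x) = optionP1 (x.map (· ^ q)) := by
  cases x with
  | none =>
    refine (frobP1_mk q _ _ (by simp [Function.ne_iff])).trans ?_
    simp only [optionP1, Option.map]
    congr 1
    ext i
    fin_cases i <;> simp [hq]
  | some t =>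
    refine (frobP1_mk q _ _ (by simp [Function.ne_iff])).trans ?_
    simp only [optionP1, Option.map]
    congr 1
    ext i
    fin_cases i <;> simp

end ProjectiveLine

section Action

variable {K : Type*} [Field K]

theorem pgl_mk_smul_mk (g : GL (Fin 2) K) (v w : Fin 2 → AlgebraicClosure K) (hv : v ≠ 0)
    (hw : w ≠ 0)
    (h : w = ((g : Matrix (Fin 2) (Fin 2) K).map (algebraMap K (AlgebraicClosure K))).mulVec v) :
    (QuotientGroup.mk g : PGL2 K) • Projectivization.mk (AlgebraicClosure K) v hv
      = Projectivization.mk (AlgebraicClosure K) w hw := by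
  show Projectivization.map (glMulEquiv _ (Matrix.GeneralLinearGroup.map
    (algebraMap K (AlgebraicClosure K)) g)).toLinearMap (LinearEquiv.injective _) (Projectivization.mk _ v hv) = _
  rw [Projectivization.map_mk]
  congr 1
  rw [h]
  exact glMulEquiv_apply _ _ _

theorem map_mulVec_ne_zero (g : GL (Fin 2) K) {v : Fin 2 → AlgebraicClosure K} (hv : v ≠ 0) :
    ((g : Matrix (Fin 2) (Fin 2) K).map (algebraMap K (AlgebraicClosure K))).mulVec v ≠ 0 := by
  have := (glMulEquiv (AlgebraicClosure K)
    (Matrix.GeneralLinearGroup.map (algebraMap K _) g)).map_ne_zero_iff.2 hv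
  rwa [glMulEquiv_apply] at this

theorem frobP1_smul [Fintype K] (g : PGL2 K)
    (x : Projectivization (AlgebraicClosure K) (Fin 2 → AlgebraicClosure K)) :
    frobP1 (Fintype.card K) (g • x) = g • frobP1 (Fintype.card K) x := by
  induction g using QuotientGroup.induction_on with
  | H g =>
  induction x using Projectivization.ind with
  | h v hv =>
    have hpow {v : Fin 2 → AlgebraicClosure K} (hv : v ≠ 0) :
        (fun i ↦ v i ^ Fintype.card K) ≠ 0 := by
      obtain ⟨i, hi⟩ := Function.ne_iff.1 hv
      exact Function.ne_iff.2 ⟨i, pow_ne_zero _ hi⟩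
    rw [pgl_mk_smul_mk g v _ hv (map_mulVec_ne_zero g hv) rfl, frobP1_mk _ _ _ (hpow hv),
      frobP1_mk _ _ _ (hpow (map_mulVec_ne_zero g hv))]
    refine (pgl_mk_smul_mk g _ _ _ _ ?_).symm
    ext i
    set F := FiniteField.frobeniusAlgHom K (AlgebraicClosure K)
    have hF (x : AlgebraicClosure K) : x ^ Fintype.card K = F x := rfl
    simp only [Matrix.mulVec, dotProduct, hF, map_sum, map_mul, Matrix.map_apply,
      AlgHom.commutes]

theorem pgl_mk_smul_optionP1_eq_iff (g : GL (Fin 2) K) {s t : AlgebraicClosure K} :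
    (QuotientGroup.mk g : PGL2 K) • optionP1 (some s) = optionP1 (some t) ↔
      algebraMap K _ (g 0 0) * s + algebraMap K _ (g 0 1)
        = t * (algebraMap K _ (g 1 0) * s + algebraMap K _ (g 1 1)) := by
  have hne := map_mulVec_ne_zero g (v := ![s, 1]) (by simp)
  have hw : ((g : Matrix (Fin 2) (Fin 2) K).map
      (algebraMap K (AlgebraicClosure K))).mulVec ![s, 1]
      = ![algebraMap K _ (g 0 0) * s + algebraMap K _ (g 0 1),
        algebraMap K _ (g 1 0) * s + algebraMap K _ (g 1 1)] := by
    ext i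
    fin_cases i <;> simp [Matrix.mulVec, dotProduct, Fin.sum_univ_two]
  rw [optionP1, pgl_mk_smul_mk g _ _ _ (hw ▸ hne) hw.symm, optionP1,
    Projectivization.mk_eq_mk_iff']
  constructor
  · rintro ⟨a, ha⟩
    have h0 := congrFun ha 0
    have h1 := congrFun ha 1
    simp only [Pi.smul_apply, smul_eq_mul, Matrix.cons_val_zero, Matrix.cons_val_one,
      mul_one] at h0 h1
    rw [← h0, ← h1, mul_comm]
  · intro h
    refine ⟨algebraMap K _ (g 1 0) * s + algebraMap K _ (g 1 1), ?_⟩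
    ext i
    fin_cases i
    · simpa [mul_comm t] using h.symm
    · simp

/-- The stabilizer in `PGL₂(K)` of an element of degree three is trivial. -/
theorem eq_one_of_smul_optionP1_eq [Fintype K] {t : AlgebraicClosure K}
    (ht : t ^ Fintype.card K ≠ t)
    (ht3 : ((t ^ Fintype.card K) ^ Fintype.card K) ^ Fintype.card K = t) (g : PGL2 K)
    (h : g • optionP1 (some t) = optionP1 (some t)) : g = 1 := by
  induction g using QuotientGroup.induction_on with
  | H g =>
  rw [pgl_mk_smul_optionP1_eq_iff] at h
  obtain ⟨h10, h01, h2⟩ := quadratic_coeff_eq_zero (K := K) (a := g 1 0) (b := g 1 1 - g 0 0)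
    (c := - g 0 1) ht ht3 (by simp only [map_sub, map_neg]; linear_combination -h)
  have h01' := sub_eq_zero.1 h01
  have h2' := neg_eq_zero.1 h2
  have hg : g 0 0 ≠ 0 := by
    intro h0
    have := g.det.ne_zero
    simp [Matrix.det_fin_two, h0, h10] at this
  rw [QuotientGroup.eq_one_iff]
  refine ⟨Units.mk0 _ hg, ?_⟩
  ext i j
  fin_cases i <;> fin_cases j <;> simp [h10, h2', h01']

end Action

/-- the number of `PGL₂(K)`-orbits of injective 4-tuples on `P¹(K̄)`
satisfying the stated Frobenius conditions. -/
theorem statement2 (q : ℕ) (hq : IsPrimePow q)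
    (K : Type*) [Field K] [Fintype K] (hK : Fintype.card K = q) :
    (Nat.card (Quotient (Setoid.comap
      (Subtype.val :
        {x : Fin 4 → Projectivization (AlgebraicClosure K) (Fin 2 → AlgebraicClosure K) //
          Function.Injective x ∧
          frobP1 q (x 0) = x 1 ∧
          frobP1 q (x 1) = x 2 ∧
          frobP1 q (x 2) = x 0 ∧
          frobP1 q (x 3) = x 3} →
        (Fin 4 → Projectivization (AlgebraicClosure K) (Fin 2 → AlgebraicClosure K)))
      (MulAction.orbitRel (PGL2 K)
        (Fin 4 → Projectivization (AlgebraicClosure K) (Fin 2 → AlgebraicClosure K))))) : ℤ)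
    = (q : ℤ) + 1 := by
  subst hK
  set q := Fintype.card K with hq'
  have hq0 : q ≠ 0 := hq.ne_zero
  have hfrob (x : Option (AlgebraicClosure K)) := frobP1_optionP1 hq0 x
  have hdistinct {t : AlgebraicClosure K} (ht : t ^ q ≠ t) (ht3 : ((t ^ q) ^ q) ^ q = t) :
      t ^ q ≠ (t ^ q) ^ q ∧ (t ^ q) ^ q ≠ t := by
    set F := FiniteField.frobeniusAlgHom K (AlgebraicClosure K)
    have hF (x : AlgebraicClosure K) : x ^ q = F x := rfl
    simp only [hF] at *
    exact ⟨fun e ↦ ht (F.injective e).symm, fun e ↦ ht (by rwa [e] at ht3)⟩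
  obtain ⟨t, ht, ht3⟩ := exists_pow_pow_pow_card_eq_self (K := K) (L := AlgebraicClosure K)
  rw [← hq'] at ht ht3
  obtain ⟨ht12, ht20⟩ := hdistinct ht ht3
  let emb : Option K → Option (AlgebraicClosure K) := Option.map (algebraMap K _)
  have hfix (x : Option (AlgebraicClosure K)) : x.map (· ^ q) = x ↔ ∃ k, emb k = x := by
    cases x with
    | none => exact ⟨fun _ ↦ ⟨none, rfl⟩, fun _ ↦ rfl⟩
    | some y =>
      simp only [Option.map_some, Option.some.injEq, hq', pow_card_eq_self_iff (K := K) y]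
      constructor
      · rintro ⟨k, rfl⟩
        exact ⟨some k, rfl⟩
      · rintro ⟨_ | k, hk⟩
        · cases hk
        · exact ⟨k, Option.some.inj hk⟩
  let tuple (k : Option K) : Fin 4 →
      Projectivization (AlgebraicClosure K) (Fin 2 → AlgebraicClosure K) :=
    optionP1 ∘ ![some t, some (t ^ q), some ((t ^ q) ^ q), emb k]
  have hinj (k : Option K) : Function.Injective (tuple k) := by
    refine optionP1_injective.comp ?_
    have hk := (hfix (emb k)).2 ⟨k, rfl⟩
    have h0 : some t ≠ emb k := fun e ↦ ht (by simpa [← e] using hk)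
    have h1 : some (t ^ q) ≠ emb k := fun e ↦ ht12 (by simpa [← e] using hk.symm)
    have h2 : some ((t ^ q) ^ q) ≠ emb k := fun e ↦ ht20 (by
      have := hk
      simp only [← e, Option.map_some, Option.some.injEq, ht3] at this
      exact this.symm)
    intro i j hij
    have h01 : some t ≠ some (t ^ q) := fun e ↦ ht (Option.some.inj e).symm
    have h12 : some (t ^ q) ≠ some ((t ^ q) ^ q) := fun e ↦ ht12 (Option.some.inj e)
    have h02 : some t ≠ some ((t ^ q) ^ q) := fun e ↦ ht20 (Option.some.inj e).symm
    fin_cases i <;> fin_cases j <;> first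
      | rfl
      | exact absurd hij (by assumption)
      | exact absurd hij (Ne.symm (by assumption))
  let T (k : Option K) : {x : Fin 4 →
      Projectivization (AlgebraicClosure K) (Fin 2 → AlgebraicClosure K) //
        Function.Injective x ∧ frobP1 q (x 0) = x 1 ∧ frobP1 q (x 1) = x 2 ∧
        frobP1 q (x 2) = x 0 ∧ frobP1 q (x 3) = x 3} :=
    ⟨tuple k, hinj k, hfrob _, hfrob _, (hfrob _).trans (congrArg (optionP1 ∘ some) ht3),
      (hfrob _).trans (congrArg optionP1 ((hfix _).2 ⟨k, rfl⟩))⟩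
  have hcard : Nat.card (Option K) = q + 1 := by
    rw [Nat.card_eq_fintype_card, Fintype.card_option]
  rw [← Nat.card_eq_of_bijective (fun k ↦ Quotient.mk _ (T k)), hcard, Nat.cast_add, Nat.cast_one]
  constructor
  · intro k k' h
    obtain ⟨g, hg⟩ := Quotient.exact h
    have hg1 : g = 1 := eq_one_of_smul_optionP1_eq ht ht3 g (congrFun hg 0)
    subst hg1
    have h3 : (1 : PGL2 K) • optionP1 (emb k') = optionP1 (emb k) := congrFun hg 3
    rw [one_smul] at h3
    exact (Option.map_injective (algebraMap K _).injective (optionP1_injective h3)).symm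
  · intro x
    induction x using Quotient.inductionOn with
    | h x =>
    obtain ⟨x, hx, h01, h12, h20, h33⟩ := x
    obtain ⟨y, hy⟩ := optionP1_surjective (x 0)
    rw [← h12, ← h01, ← hy, hfrob, hfrob, hfrob] at h20
    have h20' := optionP1_injective h20
    have h01' : optionP1 (y.map (· ^ q)) ≠ optionP1 y := by
      rw [← hfrob, hy, h01]
      exact hx.ne (by decide)
    cases y with
    | none => exact absurd rfl h01'
    | some s =>
    have hs : s ^ q ≠ s := fun e ↦ h01' (congrArg (optionP1 ∘ some) e)
    obtain ⟨g, hg⟩ := exists_gl_mul_eq (K := K) hs (Option.some.inj h20') ht ht3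
    rw [← pgl_mk_smul_optionP1_eq_iff, hy] at hg
    obtain ⟨z, hz⟩ := optionP1_surjective ((QuotientGroup.mk g : PGL2 K) • x 3)
    obtain ⟨k, rfl⟩ := (hfix z).1 (optionP1_injective (by
      rw [← hfrob, hz, frobP1_smul, h33]))
    refine ⟨k, Quotient.sound ⟨QuotientGroup.mk g, ?_⟩⟩
    have hg1 : (QuotientGroup.mk g : PGL2 K) • x 1 = optionP1 (some (t ^ q)) := by
      rw [← h01, ← frobP1_smul, hg]
      exact hfrob _
    have hg2 : (QuotientGroup.mk g : PGL2 K) • x 2 = optionP1 (some ((t ^ q) ^ q)) := by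
      rw [← h12, ← frobP1_smul, hg1]
      exact hfrob _
    funext i
    fin_cases i
    exacts [hg, hg1, hg2, hz.symm]
end

section
/- Let q be a prime power and K a finite field with q elements. The number of orbits of the componentwise action of PGL₂(K) on the set of ordered 6-tuples of pairwise distinct points of the projective line P¹(K) equals q³ − 9q² + 26q − 24. -/
open Projectivization

noncomputable instance pglP1SelfAction (K : Type*) [Field K] :
    MulAction (PGL2 K) (Projectivization K (Fin 2 → K)) :=
  pglP1Action (RingHom.id K)

theorem pgl2_mk_smul_mk {K : Type*} [Field K] (g : GL (Fin 2) K) {v : Fin 2 → K} (hv : v ≠ 0) :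
    ((g : PGL2 K) • Projectivization.mk K v hv) =
      Projectivization.map (glMulEquiv K g).toLinearMap (glMulEquiv K g).injective
        (Projectivization.mk K v hv) := by
  show glP1 K (Matrix.GeneralLinearGroup.map (RingHom.id K) g) (Projectivization.mk K v hv) = _
  rw [Matrix.GeneralLinearGroup.map_id]
  rfl

/-- A vector spanning a point fixed by `g` is a zero of the quadratic form attached to `g`. -/
theorem quadratic_eq_zero_of_pgl2_smul_eq {K : Type*} [Field K] {g : GL (Fin 2) K}
    {p : Projectivization K (Fin 2 → K)} (h : (g : PGL2 K) • p = p) :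
    g 0 1 * p.rep 1 ^ 2 + (g 0 0 - g 1 1) * (p.rep 0 * p.rep 1) - g 1 0 * p.rep 0 ^ 2 = 0 := by
  rw [← p.mk_rep, pgl2_mk_smul_mk, Projectivization.map_mk, Projectivization.mk_eq_mk_iff'] at h
  obtain ⟨c, hc⟩ := h
  have h0 := congrFun hc 0
  have h1 := congrFun hc 1
  simp [glMulEquiv_apply, Matrix.mulVec, dotProduct, Fin.sum_univ_two] at h0 h1
  linear_combination p.rep 0 * h1 - p.rep 1 * h0

theorem rep_cross_ne_zero {K : Type*} [Field K] {p r : Projectivization K (Fin 2 → K)}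
    (h : p ≠ r) : p.rep 0 * r.rep 1 - p.rep 1 * r.rep 0 ≠ 0 := by
  intro hd
  apply h
  rw [← p.mk_rep, ← r.mk_rep, Projectivization.mk_eq_mk_iff']
  have hr : r.rep 0 ≠ 0 ∨ r.rep 1 ≠ 0 := by
    by_contra! hc
    apply r.rep_nonzero
    funext i
    fin_cases i
    · exact hc.1
    · exact hc.2
  rcases hr with hr | hr
  · refine ⟨p.rep 0 / r.rep 0, ?_⟩
    funext i
    fin_cases i
    · simp [hr]
    · simp only [Fin.mk_one, Pi.smul_apply, smul_eq_mul]
      field_simp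
      linear_combination hd
  · refine ⟨p.rep 1 / r.rep 1, ?_⟩
    funext i
    fin_cases i
    · simp only [Fin.zero_eta, Pi.smul_apply, smul_eq_mul]
      field_simp
      linear_combination -hd
    · simp [hr]

/-- An element of `PGL₂(K)` fixing three distinct points of `P¹(K)` is trivial. -/
theorem pgl2_eq_one_of_three_fixed {K : Type*} [Field K] {z : PGL2 K}
    {p r s : Projectivization K (Fin 2 → K)} (hpr : p ≠ r) (hps : p ≠ s) (hrs : r ≠ s)
    (hp : z • p = p) (hr : z • r = r) (hs : z • s = s) : z = 1 := by
  induction z using QuotientGroup.induction_on with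
  | H g =>
  have ep := quadratic_eq_zero_of_pgl2_smul_eq hp
  have er := quadratic_eq_zero_of_pgl2_smul_eq hr
  have es := quadratic_eq_zero_of_pgl2_smul_eq hs
  have dpr := rep_cross_ne_zero hpr
  have dps := rep_cross_ne_zero hps
  have drs := rep_cross_ne_zero hrs
  generalize p.rep 0 = p0 at *
  generalize p.rep 1 = p1 at *
  generalize r.rep 0 = r0 at *
  generalize r.rep 1 = r1 at *
  generalize s.rep 0 = s0 at *
  generalize s.rep 1 = s1 at *
  have hD := mul_ne_zero (mul_ne_zero dpr dps) drs
  have hb : g 0 1 = 0 := by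
    apply (mul_eq_zero.mp (?_ : _ * ((p0 * r1 - p1 * r0) * (p0 * s1 - p1 * s0) *
      (r0 * s1 - r1 * s0)) = 0)).resolve_right hD
    linear_combination (r0 * s0 * (r0 * s1 - r1 * s0)) * ep
      - (p0 * s0 * (p0 * s1 - p1 * s0)) * er + (p0 * r0 * (p0 * r1 - p1 * r0)) * es
  have hc : g 1 0 = 0 := by
    apply (mul_eq_zero.mp (?_ : _ * ((p0 * r1 - p1 * r0) * (p0 * s1 - p1 * s0) *
      (r0 * s1 - r1 * s0)) = 0)).resolve_right hD
    linear_combination -(r1 * s1 * (r0 * s1 - r1 * s0)) * ep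
      + (p1 * s1 * (p0 * s1 - p1 * s0)) * er - (p1 * r1 * (p0 * r1 - p1 * r0)) * es
  have had : g 1 1 = g 0 0 := by
    refine (sub_eq_zero.mp ?_).symm
    apply (mul_eq_zero.mp (?_ : _ * ((p0 * r1 - p1 * r0) * (p0 * s1 - p1 * s0) *
      (r0 * s1 - r1 * s0)) = 0)).resolve_right hD
    linear_combination -((r0 ^ 2 * s1 ^ 2 - r1 ^ 2 * s0 ^ 2)) * ep
      + (p0 ^ 2 * s1 ^ 2 - p1 ^ 2 * s0 ^ 2) * er - (p0 ^ 2 * r1 ^ 2 - p1 ^ 2 * r0 ^ 2) * es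
  have ha : g 0 0 ≠ 0 := by
    intro ha
    have hdet := g.det.ne_zero
    apply hdet
    simp [Matrix.det_fin_two, hb, ha]
  rw [QuotientGroup.eq_one_iff]
  refine ⟨Units.mk0 _ ha, ?_⟩
  apply Units.ext
  ext i j
  fin_cases i <;> fin_cases j <;> simp [hb, hc, had]

theorem card_scalarSubgroup (K : Type*) [Field K] [Fintype K] :
    Nat.card (scalarSubgroup K) = Fintype.card K - 1 := by
  have hinj : Function.Injective
      (Units.map ((Matrix.scalar (Fin 2)) : K →+* Matrix (Fin 2) (Fin 2) K).toMonoidHom) := by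
    intro a b hab
    apply Units.ext
    have := congrArg (fun u : GL (Fin 2) K => (u : Matrix (Fin 2) (Fin 2) K) 0 0) hab
    simpa using this
  rw [scalarSubgroup, ← Nat.card_congr (MonoidHom.ofInjective hinj).toEquiv, Nat.card_units,
    Nat.card_eq_fintype_card]

theorem card_pgl2 (K : Type*) [Field K] [Fintype K] :
    (Nat.card (PGL2 K) : ℤ) =
      (Fintype.card K + 1) * Fintype.card K * (Fintype.card K - 1) := by
  have h := Subgroup.card_eq_card_quotient_mul_card_subgroup (scalarSubgroup K)
  rw [card_scalarSubgroup, Matrix.card_GL_field] at h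
  have hq : 1 < Fintype.card K := Fintype.one_lt_card
  simp only [Fin.prod_univ_two, Fin.val_zero, Fin.val_one, pow_zero, pow_one] at h
  generalize Fintype.card K = q at *
  obtain ⟨n, rfl⟩ : ∃ n, q = n + 1 := ⟨q - 1, by omega⟩
  zify at h
  rw [Nat.cast_sub (Nat.one_le_pow _ _ (by omega)),
    Nat.cast_sub (Nat.le_self_pow (by omega) _)] at h
  push_cast at h ⊢
  simp only [add_sub_cancel_right] at h ⊢
  have hn : (n : ℤ) ≠ 0 := by omega
  apply mul_right_cancel₀ hn
  linear_combination -h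

theorem stabilizer_embedding_eq_bot {K : Type*} [Field K]
    (x : Fin 6 ↪ Projectivization K (Fin 2 → K)) :
    MulAction.stabilizer (PGL2 K) x = ⊥ := by
  rw [eq_bot_iff]
  intro z hz
  have h (i : Fin 6) : z • x i = x i := DFunLike.congr_fun (MulAction.mem_stabilizer_iff.mp hz) i
  exact pgl2_eq_one_of_three_fixed (x.injective.ne (by decide : (0 : Fin 6) ≠ 1))
    (x.injective.ne (by decide : (0 : Fin 6) ≠ 2)) (x.injective.ne (by decide : (1 : Fin 6) ≠ 2))
    (h 0) (h 1) (h 2)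

theorem card_embedding_projectiveLine (K : Type*) [Field K] [Fintype K] :
    Nat.card (Fin 6 ↪ Projectivization K (Fin 2 → K)) =
      (Fintype.card K + 1).descFactorial 6 := by
  classical
  have : Fintype (Projectivization K (Fin 2 → K)) := Fintype.ofFinite _
  rw [Nat.card_eq_fintype_card, Fintype.card_embedding_eq, ← Nat.card_eq_fintype_card,
    Projectivization.card_of_finrank_two K _ (by simp), Nat.card_eq_fintype_card,
    Fintype.card_fin]

/-- the number of `PGL₂(K)`-orbits of injective 6-tuples of points
of `P¹(K)`. -/
theorem statement3 (q : ℕ) (hq : IsPrimePow q)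
    (K : Type*) [Field K] [Fintype K] (hK : Fintype.card K = q) :
    (Nat.card (Quotient (Setoid.comap
      (Subtype.val :
        {x : Fin 6 → Projectivization K (Fin 2 → K) // Function.Injective x} →
        (Fin 6 → Projectivization K (Fin 2 → K)))
      (MulAction.orbitRel (PGL2 K)
        (Fin 6 → Projectivization K (Fin 2 → K))))) : ℤ)
    = (q : ℤ) ^ 3 - 9 * (q : ℤ) ^ 2 + 26 * (q : ℤ) - 24 := by
  have hquot := Nat.card_congr (Quotient.congr
    (ra := Setoid.comap Subtype.val
      (MulAction.orbitRel (PGL2 K) (Fin 6 → Projectivization K (Fin 2 → K))))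
    (rb := MulAction.orbitRel (PGL2 K) (Fin 6 ↪ Projectivization K (Fin 2 → K)))
    (Equiv.subtypeInjectiveEquivEmbedding (Fin 6) (Projectivization K (Fin 2 → K)))
    (fun x y => exists_congr fun z =>
      ⟨fun h => DFunLike.ext' h, fun h => congrArg DFunLike.coe h⟩))
  rw [hquot]
  have hX := Nat.card_congr (MulAction.selfEquivOrbitsQuotientProd
    (G := PGL2 K) (stabilizer_embedding_eq_bot (K := K)))
  rw [card_embedding_projectiveLine, Nat.card_prod, hK] at hX
  have hG := card_pgl2 K
  have hq2 : 1 < q := hq.one_lt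
  rw [hK] at hG
  have hpos : (0 : ℤ) < (q + 1) * q * (q - 1) := by
    have : (0 : ℤ) < q - 1 := by omega
    positivity
  apply mul_right_cancel₀ hpos.ne'
  rw [← hG, ← Nat.cast_mul, ← hX, hG]
  obtain hlt | hge := lt_or_ge q 5
  · interval_cases q <;> simp [Nat.descFactorial]
  · obtain ⟨n, rfl⟩ := Nat.exists_eq_add_of_le' hge
    simp [Nat.descFactorial]
    ring
end

section
/- Let q be a prime power, K a finite field with q elements, K̄ an algebraic closure of K, and φ the Frobenius map on P¹(K̄) given by [a : b] ↦ [a^q : b^q]. The number of orbits of the componentwise action of PGL₂(K) on the set of ordered 6-tuples (x₁, …, x₆) of pairwise distinct points of P¹(K̄) satisfying φ(x₁) = x₂, φ(x₂) = x₁ and φ(xᵢ) = xᵢ for i = 3, 4, 5, 6 equals q³ − 3q² + 2q. -/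
open Projectivization

namespace ProjectiveLine

section Field

variable {L : Type*} [Field L]

theorem mk_eq_mk_iff_mul_eq_mul {v w : Fin 2 → L} (hv : v ≠ 0) (hw : w ≠ 0) :
    Projectivization.mk L v hv = Projectivization.mk L w hw ↔ v 0 * w 1 = v 1 * w 0 := by
  rw [Projectivization.mk_eq_mk_iff']
  constructor
  · rintro ⟨a, rfl⟩
    simp only [Pi.smul_apply, smul_eq_mul]
    ring
  · intro h
    by_cases h0 : w 0 = 0
    · have h1 : w 1 ≠ 0 := by
        intro h1
        exact hw (funext (Fin.forall_fin_two.2 ⟨h0, h1⟩))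
      have hv0 : v 0 = 0 := by simpa [h0, h1] using h
      refine ⟨v 1 / w 1, funext (Fin.forall_fin_two.2 ⟨?_, ?_⟩)⟩
      · simp [h0, hv0]
      · simp [h1]
    · refine ⟨v 0 / w 0, funext (Fin.forall_fin_two.2 ⟨?_, ?_⟩)⟩
      · simp [h0]
      · simp only [Pi.smul_apply, smul_eq_mul]
        field_simp
        linear_combination h

/-- The point `[a : 1]`. -/
def affinePoint (a : L) : Projectivization L (Fin 2 → L) :=
  Projectivization.mk L ![a, 1] (fun h => one_ne_zero (congrFun h 1))

variable (L) in
/-- The point `[1 : 0]`. -/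
def pointAtInfinity : Projectivization L (Fin 2 → L) :=
  Projectivization.mk L ![1, 0] (fun h => one_ne_zero (congrFun h 0))

theorem affinePoint_injective : Function.Injective (affinePoint (L := L)) := by
  intro a b h
  simpa [affinePoint, mk_eq_mk_iff_mul_eq_mul] using h

theorem affinePoint_ne_pointAtInfinity (a : L) : affinePoint a ≠ pointAtInfinity L := by
  simp [affinePoint, pointAtInfinity, mk_eq_mk_iff_mul_eq_mul]

theorem exists_eq_affinePoint {p : Projectivization L (Fin 2 → L)}
    (hp : p ≠ pointAtInfinity L) : ∃ a, p = affinePoint a := by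
  induction p using Projectivization.ind with
  | h v hv =>
    have h1 : v 1 ≠ 0 := by
      intro h1
      exact hp ((mk_eq_mk_iff_mul_eq_mul _ _).2 (by simp [h1]))
    refine ⟨v 0 / v 1, (mk_eq_mk_iff_mul_eq_mul _ _).2 ?_⟩
    simp
    field_simp

theorem frobP1_mk {q : ℕ} (v : Fin 2 → L) (hv : v ≠ 0)
    (hv' : (fun i => v i ^ q) ≠ 0) :
    frobP1 q (Projectivization.mk L v hv) = Projectivization.mk L (fun i => v i ^ q) hv' := by
  have h : Projectivization.mk L (Projectivization.mk L v hv).rep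
      (Projectivization.rep_nonzero _) = Projectivization.mk L v hv := Projectivization.mk_rep _
  rw [mk_eq_mk_iff_mul_eq_mul] at h
  rw [frobP1, mk_eq_mk_iff_mul_eq_mul, ← mul_pow, ← mul_pow, h]

theorem frobP1_affinePoint (q : ℕ) (a : L) :
    frobP1 q (affinePoint a) = affinePoint (a ^ q) := by
  rw [affinePoint, frobP1_mk _ _ (fun h => by simpa using congrFun h 1), affinePoint,
    mk_eq_mk_iff_mul_eq_mul]
  simp

theorem frobP1_pointAtInfinity {q : ℕ} (hq : q ≠ 0) :
    frobP1 q (pointAtInfinity L) = pointAtInfinity L := by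
  rw [pointAtInfinity, frobP1_mk _ _ (fun h => by simpa using congrFun h 0),
    mk_eq_mk_iff_mul_eq_mul]
  simp [hq]

end Field

section Finite

variable {K : Type*} [Field K] [Fintype K]

theorem ncard_setOf_pow_card_pow_eq_self (n : ℕ) (hn : n ≠ 0) :
    {a : AlgebraicClosure K | a ^ Fintype.card K ^ n = a}.ncard = Fintype.card K ^ n := by
  have hc : 1 < Fintype.card K ^ n := Nat.one_lt_pow hn Fintype.one_lt_card
  obtain ⟨p, hp⟩ := CharP.exists (AlgebraicClosure K)
  have : CharP K p := (RingHom.charP_iff (algebraMap K (AlgebraicClosure K))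
    (algebraMap K (AlgebraicClosure K)).injective p).2 hp
  obtain ⟨m, hpp, hm⟩ := FiniteField.card K p
  have := galois_poly_separable (K := AlgebraicClosure K) p (Fintype.card K ^ n)
    ((hm ▸ dvd_pow_self p m.ne_zero : p ∣ Fintype.card K).trans (dvd_pow_self _ hn))
  have h := Polynomial.card_rootSet_eq_natDegree (K := AlgebraicClosure K) this
    (IsAlgClosed.splits _)
  rw [← Nat.card_eq_fintype_card, Nat.card_coe_set_eq,
    FiniteField.X_pow_card_sub_X_natDegree_eq _ hc] at h
  convert h using 2
  ext a
  rw [Polynomial.mem_rootSet_of_ne (FiniteField.X_pow_card_sub_X_ne_zero _ hc)]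
  simp [sub_eq_zero]

theorem pow_card_eq_self_iff (a : AlgebraicClosure K) :
    a ^ Fintype.card K = a ↔ ∃ b : K, algebraMap K _ b = a := by
  have h : Set.range (algebraMap K (AlgebraicClosure K)) =
      {a : AlgebraicClosure K | a ^ Fintype.card K ^ 1 = a} := by
    apply Set.eq_of_subset_of_ncard_le
    · rintro _ ⟨b, rfl⟩
      simp [← map_pow, FiniteField.pow_card]
    · rw [ncard_setOf_pow_card_pow_eq_self 1 one_ne_zero, ← Set.image_univ,
        Set.ncard_image_of_injective _ (algebraMap K (AlgebraicClosure K)).injective,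
        Set.ncard_univ, pow_one, Nat.card_eq_fintype_card]
    · apply Set.finite_of_ncard_ne_zero
      rw [ncard_setOf_pow_card_pow_eq_self 1 one_ne_zero]
      simp
  have := Set.ext_iff.1 h a
  simpa using this.symm

/-- The elements of degree two over `K` in the algebraic closure of `K`. -/
abbrev QuadraticElement (K : Type*) [Field K] [Fintype K] :=
  {a : AlgebraicClosure K //
    (a ^ Fintype.card K) ^ Fintype.card K = a ∧ a ^ Fintype.card K ≠ a}

theorem card_quadraticElement :
    Nat.card (QuadraticElement K) = Fintype.card K ^ 2 - Fintype.card K := by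
  have h2 := ncard_setOf_pow_card_pow_eq_self (K := K) 2 two_ne_zero
  have h1 := ncard_setOf_pow_card_pow_eq_self (K := K) 1 one_ne_zero
  rw [pow_one] at h1
  have hsub : {a : AlgebraicClosure K | a ^ Fintype.card K = a} ⊆
      {a | a ^ Fintype.card K ^ 2 = a} := by
    intro a (ha : _ = _)
    change a ^ Fintype.card K ^ 2 = a
    rw [pow_two, pow_mul, ha, ha]
  have hfin : {a : AlgebraicClosure K | a ^ Fintype.card K = a}.Finite :=
    Set.finite_of_ncard_ne_zero (by simp [h1])
  have h := Set.ncard_sdiff hsub hfin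
  rw [h1, h2, ← Nat.card_coe_set_eq] at h
  rw [← h]
  refine Nat.card_congr (Equiv.subtypeEquivRight fun a => ?_)
  simp [pow_two, pow_mul]

theorem exists_mk_eq_of_frobP1_eq {p : Projectivization (AlgebraicClosure K)
    (Fin 2 → AlgebraicClosure K)} (hp : frobP1 (Fintype.card K) p = p) :
    ∃ (v : Fin 2 → K) (hv : (fun i => algebraMap K (AlgebraicClosure K) (v i)) ≠ 0),
      p = Projectivization.mk _ _ hv := by
  by_cases h : p = pointAtInfinity _
  · refine ⟨![1, 0], fun h => by simpa using congrFun h 0, ?_⟩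
    simp [h, pointAtInfinity, mk_eq_mk_iff_mul_eq_mul]
  · obtain ⟨a, rfl⟩ := exists_eq_affinePoint h
    rw [frobP1_affinePoint] at hp
    obtain ⟨b, rfl⟩ := (pow_card_eq_self_iff a).1 (affinePoint_injective hp)
    refine ⟨![b, 1], fun h => by simpa using congrFun h 1, ?_⟩
    simp [affinePoint, mk_eq_mk_iff_mul_eq_mul]

end Finite

/-- The projective line over the algebraic closure of `K`. -/
abbrev P1 (K : Type*) [Field K] :=
  Projectivization (AlgebraicClosure K) (Fin 2 → AlgebraicClosure K)

section Action

variable {K : Type*} [Field K]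

theorem map_mulVec_ne_zero (M : GL (Fin 2) K) {v : Fin 2 → AlgebraicClosure K} (hv : v ≠ 0) :
    ((M : Matrix (Fin 2) (Fin 2) K).map (algebraMap K (AlgebraicClosure K))).mulVec v ≠ 0 := by
  set N := Matrix.GeneralLinearGroup.map (n := Fin 2) (algebraMap K (AlgebraicClosure K)) M
  intro h
  apply hv
  apply (glMulEquiv _ N).injective
  rw [glMulEquiv_apply, map_zero]
  exact h

theorem pgl_smul_mk (M : GL (Fin 2) K) (v : Fin 2 → AlgebraicClosure K) (hv : v ≠ 0) :
    (QuotientGroup.mk M : PGL2 K) • Projectivization.mk _ v hv =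
      Projectivization.mk (AlgebraicClosure K)
        (((M : Matrix (Fin 2) (Fin 2) K).map (algebraMap K (AlgebraicClosure K))).mulVec v)
        (map_mulVec_ne_zero M hv) := by
  set N := Matrix.GeneralLinearGroup.map (n := Fin 2) (algebraMap K (AlgebraicClosure K)) M
  change Projectivization.map (glMulEquiv _ N).toLinearMap (glMulEquiv _ N).injective
    (Projectivization.mk _ v hv) = _
  rw [Projectivization.map_mk]
  congr 1

theorem frobP1_smul [Fintype K] (g : PGL2 K) (p : P1 K) :
    frobP1 (Fintype.card K) (g • p) = g • frobP1 (Fintype.card K) p := by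
  induction g using QuotientGroup.induction_on with
  | H M =>
  induction p using Projectivization.ind with
  | h v hv =>
    have hpow {w : Fin 2 → AlgebraicClosure K} (hw : w ≠ 0) :
        (fun i => w i ^ Fintype.card K) ≠ 0 := by
      intro h
      exact hw (funext fun i => (pow_eq_zero_iff Fintype.card_ne_zero).1 (congrFun h i))
    rw [pgl_smul_mk, frobP1_mk _ _ (hpow hv),
      frobP1_mk _ _ (hpow (map_mulVec_ne_zero M hv)),
      pgl_smul_mk]
    have hadd (a b : AlgebraicClosure K) :
        (a + b) ^ Fintype.card K = a ^ Fintype.card K + b ^ Fintype.card K :=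
      map_add (FiniteField.frobeniusAlgHom K (AlgebraicClosure K)) a b
    congr 1
    ext i
    simp only [Matrix.mulVec, dotProduct, Fin.sum_univ_two, Matrix.map_apply, hadd, mul_pow,
      ← map_pow, FiniteField.pow_card]

/-- `PGL₂(K)` is transitive on triples of distinct `K`-rational points. -/
theorem exists_smul_eq_triple [Fintype K] {x y z : P1 K}
    (hx : frobP1 (Fintype.card K) x = x) (hy : frobP1 (Fintype.card K) y = y)
    (hz : frobP1 (Fintype.card K) z = z) (hxy : x ≠ y) (hxz : x ≠ z) (hyz : y ≠ z) :
    ∃ g : PGL2 K, g • pointAtInfinity _ = x ∧ g • affinePoint 0 = y ∧ g • affinePoint 1 = z := by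
  obtain ⟨u, hu, rfl⟩ := exists_mk_eq_of_frobP1_eq hx
  obtain ⟨v, hv, rfl⟩ := exists_mk_eq_of_frobP1_eq hy
  obtain ⟨w, hw, rfl⟩ := exists_mk_eq_of_frobP1_eq hz
  rw [Ne, mk_eq_mk_iff_mul_eq_mul] at hxy hxz hyz
  simp only [← map_mul, (algebraMap K (AlgebraicClosure K)).injective.eq_iff] at hxy hxz hyz
  have hα : w 0 * v 1 - w 1 * v 0 ≠ 0 := fun h => hyz (by linear_combination -h)
  have hβ : u 0 * w 1 - u 1 * w 0 ≠ 0 := sub_ne_zero.2 hxz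
  set α := w 0 * v 1 - w 1 * v 0 with hαdef
  set β := u 0 * w 1 - u 1 * w 0 with hβdef
  let M : GL (Fin 2) K := Matrix.GeneralLinearGroup.mkOfDetNeZero
    !![α * u 0, β * v 0; α * u 1, β * v 1] (by
      rw [Matrix.det_fin_two_of]
      intro h
      have : α * β * (u 0 * v 1 - u 1 * v 0) = 0 := by linear_combination h
      exact mul_ne_zero (mul_ne_zero hα hβ) (sub_ne_zero.2 hxy) this)
  have hM : (M : Matrix (Fin 2) (Fin 2) K) = !![α * u 0, β * v 0; α * u 1, β * v 1] := rfl
  refine ⟨QuotientGroup.mk M, ?_, ?_, ?_⟩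
  · rw [pointAtInfinity, pgl_smul_mk, mk_eq_mk_iff_mul_eq_mul, hM]
    simp [Matrix.mulVec, dotProduct, Fin.sum_univ_two]
    ring
  · rw [affinePoint, pgl_smul_mk, mk_eq_mk_iff_mul_eq_mul, hM]
    simp [Matrix.mulVec, dotProduct, Fin.sum_univ_two]
    ring
  · rw [affinePoint, pgl_smul_mk, mk_eq_mk_iff_mul_eq_mul, hM]
    simp [Matrix.mulVec, dotProduct, Fin.sum_univ_two, hαdef, hβdef]
    ring

theorem smul_eq_self_of_fixes_triple {g : PGL2 K}
    (hinf : g • pointAtInfinity _ = pointAtInfinity (AlgebraicClosure K))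
    (h0 : g • affinePoint 0 = affinePoint (0 : AlgebraicClosure K))
    (h1 : g • affinePoint 1 = affinePoint (1 : AlgebraicClosure K)) (p : P1 K) : g • p = p := by
  induction g using QuotientGroup.induction_on with
  | H M =>
  rw [pointAtInfinity, pgl_smul_mk, mk_eq_mk_iff_mul_eq_mul] at hinf
  rw [affinePoint, pgl_smul_mk, mk_eq_mk_iff_mul_eq_mul] at h0 h1
  simp [Matrix.mulVec, dotProduct, Fin.sum_univ_two] at hinf h0 h1
  have hinf' : (M : Matrix (Fin 2) (Fin 2) K) 1 0 = 0 :=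
    (map_eq_zero (algebraMap K (AlgebraicClosure K))).1 hinf.symm
  rw [hinf', h0, map_zero, add_zero, zero_add,
    (algebraMap K (AlgebraicClosure K)).injective.eq_iff] at h1
  induction p using Projectivization.ind with
  | h v hv =>
    rw [pgl_smul_mk, mk_eq_mk_iff_mul_eq_mul]
    simp [Matrix.mulVec, dotProduct, Fin.sum_univ_two, hinf', h0, h1]
    ring

end Action

section Orbits

variable {K : Type*} [Field K] [Fintype K]

/-- Six-tuples of distinct points whose first two entries are exchanged by Frobenius and whose
last four are fixed by it. -/
def IsFrobeniusTuple (x : Fin 6 → P1 K) : Prop :=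
  Function.Injective x ∧
    frobP1 (Fintype.card K) (x 0) = x 1 ∧
    frobP1 (Fintype.card K) (x 1) = x 0 ∧
    frobP1 (Fintype.card K) (x 2) = x 2 ∧
    frobP1 (Fintype.card K) (x 3) = x 3 ∧
    frobP1 (Fintype.card K) (x 4) = x 4 ∧
    frobP1 (Fintype.card K) (x 5) = x 5

theorem IsFrobeniusTuple.smul {x : Fin 6 → P1 K} (hx : IsFrobeniusTuple x) (g : PGL2 K) :
    IsFrobeniusTuple (g • x) := by
  obtain ⟨hinj, h0, h1, h2, h3, h4, h5⟩ := hx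
  refine ⟨(MulAction.injective g).comp hinj, ?_, ?_, ?_, ?_, ?_, ?_⟩ <;>
    simp only [Pi.smul_apply, frobP1_smul, h0, h1, h2, h3, h4, h5]

/-- The tuple `([a : 1], [a ^ q : 1], ∞, 0, 1, [b : 1])`. -/
noncomputable def normalizedTuple (a : AlgebraicClosure K) (b : K) : Fin 6 → P1 K :=
  ![affinePoint a, affinePoint (a ^ Fintype.card K), pointAtInfinity _, affinePoint 0,
    affinePoint 1, affinePoint (algebraMap K _ b)]

theorem isFrobeniusTuple_normalizedTuple (a : QuadraticElement K) {b : K}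
    (hb : b ≠ 0 ∧ b ≠ 1) : IsFrobeniusTuple (normalizedTuple a.1 b) := by
  obtain ⟨a, ha, ha'⟩ := a
  have hrat (c : K) : algebraMap K (AlgebraicClosure K) c ≠ a := by
    rintro rfl
    exact ha' ((pow_card_eq_self_iff _).2 ⟨c, rfl⟩)
  have hrat' (c : K) : algebraMap K (AlgebraicClosure K) c ≠ a ^ Fintype.card K := by
    intro h
    apply hrat c
    rw [← ha, ← h, (pow_card_eq_self_iff _).2 ⟨c, rfl⟩]
  have h0 := hrat 0
  have h1 := hrat 1
  have h0' := hrat' 0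
  have h1' := hrat' 1
  rw [map_zero] at h0 h0'
  rw [map_one] at h1 h1'
  refine ⟨?_, ?_, ?_, ?_, ?_, ?_, ?_⟩
  · have hinf := affinePoint_ne_pointAtInfinity (L := AlgebraicClosure K)
    have hinf' (c : AlgebraicClosure K) := (hinf c).symm
    have hb0 : 0 ≠ algebraMap K (AlgebraicClosure K) b := Ne.symm (by simp [hb.1])
    have hb1 : 1 ≠ algebraMap K (AlgebraicClosure K) b := Ne.symm (by simp [hb.2])
    intro i j h
    fin_cases i <;> fin_cases j <;>
      simp [normalizedTuple, affinePoint_injective.eq_iff, hinf, hinf', ha', ha'.symm, h0, h0.symm,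
        h1, h1.symm, h0', h1', h1'.symm, hrat, hrat', (hrat _).symm, (hrat' _).symm,
        hb.1, hb.2, hb0, hb1] at h ⊢
  · simp [normalizedTuple, frobP1_affinePoint]
  · simp [normalizedTuple, frobP1_affinePoint, ha]
  · simp [normalizedTuple, frobP1_pointAtInfinity]
  · simp [normalizedTuple, frobP1_affinePoint]
  · simp [normalizedTuple, frobP1_affinePoint]
  · simp [normalizedTuple, frobP1_affinePoint, ← map_pow, FiniteField.pow_card]

theorem IsFrobeniusTuple.exists_smul_eq_normalizedTuple {x : Fin 6 → P1 K}
    (hx : IsFrobeniusTuple x) :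
    ∃ (g : PGL2 K) (a : QuadraticElement K) (b : {b : K // b ≠ 0 ∧ b ≠ 1}),
      g • x = normalizedTuple a.1 b.1 := by
  obtain ⟨g, hg2, hg3, hg4⟩ := exists_smul_eq_triple hx.2.2.2.1 hx.2.2.2.2.1 hx.2.2.2.2.2.1
    (hx.1.ne (by decide)) (hx.1.ne (by decide)) (hx.1.ne (by decide))
  have hy := hx.smul g⁻¹
  set y := g⁻¹ • x with hydef
  have h2 : y 2 = pointAtInfinity _ := by rw [hydef, Pi.smul_apply, ← hg2, inv_smul_smul]
  have h3 : y 3 = affinePoint 0 := by rw [hydef, Pi.smul_apply, ← hg3, inv_smul_smul]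
  have h4 : y 4 = affinePoint 1 := by rw [hydef, Pi.smul_apply, ← hg4, inv_smul_smul]
  obtain ⟨hinj, hy0, hy1, -, -, -, hy5⟩ := hy
  obtain ⟨a, ha⟩ := exists_eq_affinePoint (p := y 0) (h2 ▸ hinj.ne (by decide))
  obtain ⟨c, hc⟩ := exists_eq_affinePoint (p := y 5) (h2 ▸ hinj.ne (by decide))
  rw [ha, frobP1_affinePoint] at hy0
  rw [ha, ← hy0, frobP1_affinePoint] at hy1
  rw [hc, frobP1_affinePoint] at hy5
  obtain ⟨b, rfl⟩ := (pow_card_eq_self_iff c).1 (affinePoint_injective hy5)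
  refine ⟨g⁻¹, ⟨a, affinePoint_injective hy1, fun h => ?_⟩, ⟨b, ?_, ?_⟩, ?_⟩
  · rw [h, ← ha] at hy0
    exact absurd (hinj hy0) (by decide)
  · rintro rfl
    rw [map_zero, ← h3] at hc
    exact absurd (hinj hc) (by decide)
  · rintro rfl
    rw [map_one, ← h4] at hc
    exact absurd (hinj hc) (by decide)
  · funext i
    fin_cases i
    exacts [ha, hy0.symm, h2, h3, h4, hc]

theorem eq_of_smul_normalizedTuple_eq {g : PGL2 K} {a a' : AlgebraicClosure K} {b b' : K}
    (h : g • normalizedTuple a b = normalizedTuple a' b') : a = a' ∧ b = b' := by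
  have hg := smul_eq_self_of_fixes_triple (congrFun h 2) (congrFun h 3) (congrFun h 4)
  have h0 := (hg _).symm.trans (congrFun h 0)
  have h5 := (hg _).symm.trans (congrFun h 5)
  exact ⟨affinePoint_injective h0,
    (algebraMap K (AlgebraicClosure K)).injective (affinePoint_injective h5)⟩

variable (K) in
theorem card_orbits_isFrobeniusTuple :
    Nat.card (Quotient (Setoid.comap (Subtype.val : {x : Fin 6 → P1 K // IsFrobeniusTuple x} → _)
      (MulAction.orbitRel (PGL2 K) (Fin 6 → P1 K)))) =
    (Fintype.card K ^ 2 - Fintype.card K) * (Fintype.card K - 2) := by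
  classical
  have hcard : Nat.card {b : K // b ≠ 0 ∧ b ≠ 1} = Fintype.card K - 2 := by
    rw [← Finset.card_pair (zero_ne_one (α := K)), ← Finset.card_compl,
      Nat.subtype_card]
    simp
  rw [← card_quadraticElement, ← hcard, ← Nat.card_prod]
  symm
  refine Nat.card_congr (Equiv.ofBijective (fun t => Quotient.mk _
    ⟨normalizedTuple t.1.1 t.2.1, isFrobeniusTuple_normalizedTuple t.1 t.2.2⟩) ⟨?_, ?_⟩)
  · rintro ⟨a, b⟩ ⟨a', b'⟩ h
    have hrel : normalizedTuple a.1 b.1 ∈ MulAction.orbit (PGL2 K) (normalizedTuple a'.1 b'.1) :=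
      MulAction.orbitRel_apply.1 (Setoid.comap_rel _ _ _ _ |>.1 (Quotient.eq.1 h))
    obtain ⟨g, hg⟩ := hrel
    obtain ⟨ha, hb⟩ := eq_of_smul_normalizedTuple_eq hg
    exact Prod.ext (Subtype.ext ha.symm) (Subtype.ext hb.symm)
  · intro t
    induction t using Quotient.inductionOn with
    | h x =>
      obtain ⟨g, a, b, h⟩ := x.2.exists_smul_eq_normalizedTuple
      exact ⟨(a, b), Quotient.sound (MulAction.orbitRel_apply.2 ⟨g, h⟩)⟩

end Orbits

end ProjectiveLine

/-- the number of `PGL₂(K)`-orbits of injective 6-tuples on `P¹(K̄)`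
satisfying the stated Frobenius conditions. -/
theorem statement4 (q : ℕ) (hq : IsPrimePow q)
    (K : Type*) [Field K] [Fintype K] (hK : Fintype.card K = q) :
    (Nat.card (Quotient (Setoid.comap
      (Subtype.val :
        {x : Fin 6 → Projectivization (AlgebraicClosure K) (Fin 2 → AlgebraicClosure K) //
          Function.Injective x ∧
          frobP1 q (x 0) = x 1 ∧
          frobP1 q (x 1) = x 0 ∧
          frobP1 q (x 2) = x 2 ∧
          frobP1 q (x 3) = x 3 ∧
          frobP1 q (x 4) = x 4 ∧
          frobP1 q (x 5) = x 5} →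
        (Fin 6 → Projectivization (AlgebraicClosure K) (Fin 2 → AlgebraicClosure K)))
      (MulAction.orbitRel (PGL2 K)
        (Fin 6 → Projectivization (AlgebraicClosure K) (Fin 2 → AlgebraicClosure K))))) : ℤ)
    = (q : ℤ) ^ 3 - 3 * (q : ℤ) ^ 2 + 2 * (q : ℤ) := by
  subst hK
  refine (congrArg Nat.cast (ProjectiveLine.card_orbits_isFrobeniusTuple K)).trans ?_
  have h1 : 2 ≤ Fintype.card K := Fintype.one_lt_card
  rw [Nat.cast_mul, Nat.cast_sub (Nat.le_self_pow two_ne_zero _), Nat.cast_sub h1]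
  push_cast
  ring
end
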